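/- arXiv:2311.00869 — 3 statements merged into one kernel-verified Lean document; each statement's English description precedes it below -/
import Mathlib

section
/- (Harary) A signed graph Σ = (G, σ) with G connected is balanced if and only if for every pair of vertices (n_i, n_j) of G, all paths from n_i to n_j have the same sign (the product of the edge signs along any two n_i–n_j paths is equal). -/
namespace SimpleGraph.Walk

variable {V : Type*} {G : SimpleGraph V} {σ : Sym2 V → ℤ}

/-- The sign of a walk with respect to a `±1`-valued signing squares to `1`. -/
lemma sign_mul_self (hσ : ∀ e ∈ G.edgeSet, σ e = 1 ∨ σ e = -1) {u v : V} (p : G.Walk u v) :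
    (p.edges.map σ).prod * (p.edges.map σ).prod = 1 := by
  induction p with
  | nil => simp
  | cons h p ih =>
    rw [edges_cons, List.map_cons, List.prod_cons, mul_mul_mul_comm, ih]
    rcases hσ _ ((SimpleGraph.mem_edgeSet G).2 h) with h | h <;> simp [h]

/-- In a balanced signed graph, an edge closing a path up has the same sign as the path. -/
lemma sign_edge_mul_path (hσ : ∀ e ∈ G.edgeSet, σ e = 1 ∨ σ e = -1)
    (hbal : ∀ (v : V) (c : G.Walk v v), c.IsCycle → (c.edges.map σ).prod = 1)
    {u v : V} (h : G.Adj u v) {p : G.Walk v u} (hp : p.IsPath) :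
    σ s(u, v) * (p.edges.map σ).prod = 1 := by
  by_cases he : s(u, v) ∈ p.edges
  · have hpe : p = h.symm.toWalk := hp.eq_adj_toWalk_of_mem_edges (Sym2.eq_swap ▸ he)
    have := sign_mul_self hσ h.toWalk
    simpa [hpe, Sym2.eq_swap (a := v)] using this
  · simpa using hbal u (cons h p) ((cons_isCycle_iff p h).2 ⟨hp, he⟩)

/-- In a balanced signed graph, bypassing repeated vertices preserves the sign of a walk. -/
lemma sign_bypass [DecidableEq V] (hσ : ∀ e ∈ G.edgeSet, σ e = 1 ∨ σ e = -1)
    (hbal : ∀ (v : V) (c : G.Walk v v), c.IsCycle → (c.edges.map σ).prod = 1)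
    {u v : V} (p : G.Walk u v) :
    (p.bypass.edges.map σ).prod = (p.edges.map σ).prod := by
  induction p with
  | nil => rfl
  | @cons u w v h p ih =>
    rw [edges_cons, List.map_cons, List.prod_cons, ← ih]
    simp only [bypass]
    split_ifs with hs
    · have hc := sign_edge_mul_path hσ hbal h (p.bypass_isPath.takeUntil hs)
      conv_rhs => rw [← take_spec p.bypass hs]
      rw [edges_append, List.map_append, List.prod_append, ← mul_assoc, hc, one_mul]
    · simp

end SimpleGraph.Walk

open SimpleGraph.Walk in
/-- Harary: A signed graph `(G, σ)` with `G` connected (and `σ` taking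
values `±1` on the edges) is balanced — every cycle is positive — if and only if for every
pair of vertices, all paths between them have the same sign (the product of the edge signs
along any two such paths is equal). -/
theorem stmt_6 {V : Type*}
    (G : SimpleGraph V) (hG : G.Connected) (σ : Sym2 V → ℤ)
    (hσ : ∀ e ∈ G.edgeSet, σ e = 1 ∨ σ e = -1) :
    (∀ (v : V) (c : G.Walk v v), c.IsCycle → (c.edges.map σ).prod = 1) ↔
    (∀ (x y : V) (p q : G.Walk x y), p.IsPath → q.IsPath →
      (p.edges.map σ).prod = (q.edges.map σ).prod) := by
  classical
  constructor
  · intro hbal x y p q _ _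
    have h := sign_bypass hσ hbal (p.append q.reverse)
    rw [(isPath_iff_nil.1 (bypass_isPath _)).eq_nil] at h
    simp only [edges_nil, List.map_nil, List.prod_nil, edges_append, edges_reverse,
      List.map_append, List.prod_append, List.map_reverse, List.prod_reverse] at h
    have hq := sign_mul_self hσ q
    rw [← mul_one (List.prod (p.edges.map σ)), ← hq, ← mul_assoc, ← h, one_mul]
  · intro hpath v c hc
    cases c with
    | nil => simp
    | cons h p =>
      have hp := ((cons_isCycle_iff p h).1 hc).1
      have hpe := hpath _ _ p h.symm.toWalk hp h.symm.isPath_toWalk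
      have := sign_mul_self hσ h.toWalk
      rw [edges_cons, List.map_cons, List.prod_cons, hpe]
      simpa [Sym2.eq_swap] using this
end

section
/- (Harary) A signed graph Σ = (G, σ) is balanced if and only if there exists a bipartition of the vertex set into sets U and W such that an edge is negative if and only if it has one endpoint in U and one endpoint in W (the Harary bipartition). -/
/-- A signed graph `(G, σ)` is balanced if every cycle of `G` is positive, i.e. the
product of the edge signs along the cycle is `+1`. -/
def IsBalanced {V : Type*} (G : SimpleGraph V) (σ : Sym2 V → ℤ) : Prop :=
  ∀ (v : V) (c : G.Walk v v), c.IsCycle → (c.edges.map σ).prod = 1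

/-- The sign of a walk: the product of the signs of its edges. -/
def walkSign {V : Type*} {G : SimpleGraph V} (σ : Sym2 V → ℤ) {u v : V} (p : G.Walk u v) : ℤ :=
  (p.edges.map σ).prod

section WalkSign

open SimpleGraph

variable {V : Type*} {G : SimpleGraph V} {σ : Sym2 V → ℤ}

@[simp]
lemma walkSign_nil (u : V) : walkSign σ (Walk.nil : G.Walk u u) = 1 := by
  simp [walkSign]

@[simp]
lemma walkSign_cons {u v w : V} (h : G.Adj u v) (p : G.Walk v w) :
    walkSign σ (Walk.cons h p) = σ s(u, v) * walkSign σ p := by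
  simp [walkSign]

lemma walkSign_append {u v w : V} (p : G.Walk u v) (q : G.Walk v w) :
    walkSign σ (p.append q) = walkSign σ p * walkSign σ q := by
  simp [walkSign]

lemma walkSign_reverse {u v : V} (p : G.Walk u v) :
    walkSign σ p.reverse = walkSign σ p := by
  simp [walkSign, List.prod_reverse]

lemma walkSign_eq_one_or_neg_one (hσ : ∀ e ∈ G.edgeSet, σ e = 1 ∨ σ e = -1) {u v : V}
    (p : G.Walk u v) : walkSign σ p = 1 ∨ walkSign σ p = -1 := by
  induction p with
  | nil => simp
  | cons h p ih =>
    rcases hσ _ ((G.mem_edgeSet).2 h) with h₁ | h₁ <;> rcases ih with h₂ | h₂ <;> simp [h₁, h₂]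

lemma walkSign_mul_self (hσ : ∀ e ∈ G.edgeSet, σ e = 1 ∨ σ e = -1) {u v : V}
    (p : G.Walk u v) : walkSign σ p * walkSign σ p = 1 := by
  rcases walkSign_eq_one_or_neg_one hσ p with h | h <;> simp [h]

/-- Closing up a path by an edge gives a cycle, or traverses one edge back and forth. -/
lemma IsBalanced.walkSign_cons_isPath (hb : IsBalanced G σ)
    (hσ : ∀ e ∈ G.edgeSet, σ e = 1 ∨ σ e = -1) {u v : V} (h : G.Adj u v) {p : G.Walk v u}
    (hp : p.IsPath) : walkSign σ (Walk.cons h p) = 1 := by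
  by_cases he : s(u, v) ∈ p.edges
  · rw [Sym2.eq_swap] at he
    rw [hp.eq_adj_toWalk_of_mem_edges he]
    rcases hσ _ ((G.mem_edgeSet).2 h) with h₁ | h₁ <;>
      simp [Adj.toWalk, h₁, Sym2.eq_swap (a := v) (b := u)]
  · exact hb u _ ((Walk.cons_isCycle_iff p h).2 ⟨hp, he⟩)

lemma IsBalanced.walkSign_bypass [DecidableEq V] (hb : IsBalanced G σ)
    (hσ : ∀ e ∈ G.edgeSet, σ e = 1 ∨ σ e = -1) {u v : V} (p : G.Walk u v) :
    walkSign σ p.bypass = walkSign σ p := by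
  induction p with
  | nil => rfl
  | @cons u v w h p ih =>
    rw [Walk.bypass, walkSign_cons, ← ih]
    split_ifs with hs
    · have hc := hb.walkSign_cons_isPath hσ h (p.bypass_isPath.takeUntil hs)
      have hd := walkSign_append (σ := σ) (p.bypass.takeUntil u hs) (p.bypass.dropUntil u hs)
      rw [Walk.take_spec] at hd
      rw [walkSign_cons] at hc
      rw [hd, ← mul_assoc, hc, one_mul]
    · rw [walkSign_cons]

lemma IsBalanced.walkSign_closed (hb : IsBalanced G σ)
    (hσ : ∀ e ∈ G.edgeSet, σ e = 1 ∨ σ e = -1) {u : V} (p : G.Walk u u) :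
    walkSign σ p = 1 := by
  classical
  rw [← hb.walkSign_bypass hσ, (Walk.isPath_iff_nil.1 p.bypass_isPath).eq_nil, walkSign_nil]

/-- A balanced signing is switching equivalent to the all-positive one. -/
lemma IsBalanced.exists_switching (hb : IsBalanced G σ)
    (hσ : ∀ e ∈ G.edgeSet, σ e = 1 ∨ σ e = -1) :
    ∃ f : V → ℤ, (∀ v, f v = 1 ∨ f v = -1) ∧ ∀ x y, G.Adj x y → σ s(x, y) = f x * f y := by
  have hr (c : G.ConnectedComponent) (v : V) (hv : G.connectedComponentMk v = c) :
      Nonempty (G.Walk c.out v) :=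
    ConnectedComponent.exact ((Quot.out_eq c).trans hv.symm)
  let q (v : V) : G.Walk (G.connectedComponentMk v).out v := (hr _ v rfl).some
  refine ⟨fun v ↦ walkSign σ (q v), fun v ↦ walkSign_eq_one_or_neg_one hσ _, fun x y h ↦ ?_⟩
  have hxy : G.connectedComponentMk y = G.connectedComponentMk x :=
    (ConnectedComponent.connectedComponentMk_eq_of_adj h).symm
  suffices ∀ (r : V) (a : G.Walk r x) (b : G.Walk r y),
      σ s(x, y) = walkSign σ a * walkSign σ b by
    have := this _ (q x) ((q y).copy (by rw [hxy]) rfl)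
    simpa [walkSign] using this
  intro r a b
  have hc := hb.walkSign_closed hσ (Walk.cons h (b.reverse.append a))
  rw [walkSign_cons, walkSign_append, walkSign_reverse] at hc
  linear_combination (walkSign σ a * walkSign σ b) * hc -
    σ s(x, y) * walkSign σ b * walkSign σ b * walkSign_mul_self hσ a -
    σ s(x, y) * walkSign_mul_self hσ b

lemma walkSign_eq_mul_of_switching {f : V → ℤ} (hf : ∀ v, f v = 1 ∨ f v = -1)
    (h : ∀ x y, G.Adj x y → σ s(x, y) = f x * f y) {u v : V} (p : G.Walk u v) :
    walkSign σ p = f u * f v := by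
  induction p with
  | @nil u => rcases hf u with hu | hu <;> simp [hu]
  | @cons u v w huv p ih =>
    rw [walkSign_cons, ih, h u v huv]
    rcases hf v with hv | hv <;> simp [hv]

end WalkSign

/-- Harary: A signed graph `(G, σ)` is balanced if and only if there is a
bipartition of the vertex set into sets `U` and `W` such that an edge is negative if and
only if it has one endpoint in `U` and one endpoint in `W` (the Harary bipartition). -/
theorem stmt_8 {V : Type*}
    (G : SimpleGraph V) (σ : Sym2 V → ℤ)
    (hσ : ∀ e ∈ G.edgeSet, σ e = 1 ∨ σ e = -1) :
    IsBalanced G σ ↔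
      ∃ U W : Set V, U ∪ W = Set.univ ∧ Disjoint U W ∧
        ∀ x y : V, G.Adj x y →
          (σ s(x, y) = -1 ↔ ((x ∈ U ∧ y ∈ W) ∨ (x ∈ W ∧ y ∈ U))) := by
  classical
  constructor
  · intro hb
    obtain ⟨f, hf, h⟩ := hb.exists_switching hσ
    refine ⟨{v | f v = 1}, {v | f v = 1}ᶜ, Set.union_compl_self _, disjoint_compl_right,
      fun x y hxy ↦ ?_⟩
    rw [h x y hxy]
    rcases hf x with hx | hx <;> rcases hf y with hy | hy <;> simp [hx, hy]
  · rintro ⟨U, W, hUW, hd, h⟩ v c -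
    obtain rfl : W = Uᶜ := (IsCompl.of_eq hd.eq_bot hUW).compl_eq.symm
    let f : V → ℤ := fun v ↦ if v ∈ U then 1 else -1
    have hf (v : V) : f v = 1 ∨ f v = -1 := by grind
    have hs (x y : V) (hxy : G.Adj x y) : σ s(x, y) = f x * f y := by
      have h₁ := h x y hxy
      have h₂ := hσ _ ((G.mem_edgeSet).2 hxy)
      by_cases hx : x ∈ U <;> by_cases hy : y ∈ U <;> simp_all [f]
    have hc := walkSign_eq_mul_of_switching hf hs c
    rw [walkSign] at hc
    rcases hf v with hv | hv <;> simpa [hv] using hc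
end

section
/- Let Σ = (G, σ) be a signed graph with G connected. Then the frustration index equals the minimum over all spanning trees T of G of the number of non-tree edges whose fundamental cycle with respect to T is negative: Fr(Σ) = min_T s(T), where s(T) is the number of negative fundamental cycles of Σ with respect to T. In particular, there exists a spanning tree for which the tree-based balancing procedure switches exactly Fr(Σ) edge signs. -/
/-- The frustration index of the signed graph `(G, σ)`: the minimum number of edges whose
signs must be switched so that the resulting signed graph is balanced. -/
noncomputable def frustration {V : Type*} [DecidableEq V]
    (G : SimpleGraph V) (σ : Sym2 V → ℤ) : ℕ :=
  sInf {n : ℕ | ∃ S : Finset (Sym2 V), ↑S ⊆ G.edgeSet ∧ S.card = n ∧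
    IsBalanced G (fun e => if e ∈ S then -σ e else σ e)}

/-- The number `s(T)` of non-tree edges of `G` whose fundamental cycle with respect to the
spanning tree `T` is negative. -/
noncomputable def negFundCount {V : Type*} (G T : SimpleGraph V) (σ : Sym2 V → ℤ) : ℕ :=
  {e : Sym2 V | e ∈ G.edgeSet ∧ e ∉ T.edgeSet ∧
    ∃ (x y : V) (p : T.Walk x y), p.IsPath ∧ e = s(x, y) ∧
      σ e * (p.edges.map σ).prod = -1}.ncard

/-- The signing of unordered pairs induced by a potential `θ : V → ℤˣ`. -/
def potentialSign {V : Type*} (θ : V → ℤˣ) (e : Sym2 V) : ℤ :=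
  ((e.map θ).mul : ℤˣ)

/-- The edges of `G` on which `σ` disagrees with the signing induced by `θ`. -/
noncomputable def disagreement {V : Type*} [Fintype V] (G : SimpleGraph V) (σ : Sym2 V → ℤ)
    (θ : V → ℤˣ) : Finset (Sym2 V) :=
  {e : Sym2 V | e ∈ G.edgeSet ∧ σ e ≠ potentialSign θ e}.toFinite.toFinset

section

variable {V : Type*} {G : SimpleGraph V} {σ : Sym2 V → ℤ} {θ : V → ℤˣ}

@[simp]
lemma potentialSign_mk (x y : V) : potentialSign θ s(x, y) = (θ x : ℤ) * θ y := by
  simp [potentialSign]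

lemma potentialSign_eq_or (e : Sym2 V) : potentialSign θ e = 1 ∨ potentialSign θ e = -1 :=
  Int.isUnit_iff.mp (Units.isUnit _)

lemma prod_edges_eq_of_potential (h : ∀ e ∈ G.edgeSet, σ e = potentialSign θ e) {x y : V}
    (p : G.Walk x y) : (p.edges.map σ).prod = potentialSign θ s(x, y) := by
  induction p with
  | nil => simp
  | @cons u v w hadj p ih =>
    rw [SimpleGraph.Walk.edges_cons, List.map_cons, List.prod_cons, ih, h _ hadj]
    simp only [potentialSign_mk]
    have := Int.units_coe_mul_self (θ v)
    linear_combination (θ u * θ w : ℤ) * this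

lemma isBalanced_of_potential (h : ∀ e ∈ G.edgeSet, σ e = potentialSign θ e) :
    IsBalanced G σ := by
  intro v c _
  simp [prod_edges_eq_of_potential h c]

variable [Fintype V]

@[simp]
lemma mem_disagreement {e : Sym2 V} :
    e ∈ disagreement G σ θ ↔ e ∈ G.edgeSet ∧ σ e ≠ potentialSign θ e := by
  simp [disagreement]

/-- For a potential with the fewest disagreements, the edges of agreement connect the graph. -/
lemma connected_deleteEdges_disagreement (hG : G.Connected)
    (hσ : ∀ e ∈ G.edgeSet, σ e = 1 ∨ σ e = -1)
    (hmin : ∀ θ', (disagreement G σ θ).card ≤ (disagreement G σ θ').card) :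
    (G.deleteEdges (disagreement G σ θ)).Connected := by
  classical
  set H := G.deleteEdges (disagreement G σ θ) with hH
  have hadj {x y : V} (h : G.Adj x y) (hs : σ s(x, y) = θ x * θ y) : H.Adj x y := by
    simp [hH, h, hs]
  have := hG.nonempty
  refine ⟨fun u v => ?_⟩
  by_contra huv
  let C : Set V := {w | H.Reachable u w}
  obtain ⟨p⟩ := hG.preconnected u v
  obtain ⟨d, -, hd₁, hd₂⟩ := p.exists_boundary_dart C (SimpleGraph.Reachable.refl u) huv
  let θ' : V → ℤˣ := fun w => if w ∈ C then -θ w else θ w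
  refine absurd (hmin θ') (not_le.mpr (Finset.card_lt_card ?_))
  refine (Finset.ssubset_iff_of_subset ?_).mpr ⟨s(d.fst, d.snd), ?_, ?_⟩
  · intro e
    induction e with | _ x y
    simp only [mem_disagreement, SimpleGraph.mem_edgeSet, potentialSign_mk]
    refine fun ⟨h, hne⟩ => ⟨h, fun hs => hne ?_⟩
    have hxy := hadj h hs
    have hC : x ∈ C ↔ y ∈ C :=
      ⟨fun hx => hx.trans hxy.reachable, fun hy => hy.trans hxy.symm.reachable⟩
    by_cases hx : x ∈ C <;> simp [θ', ← hC, hx, hs]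
  · simp only [mem_disagreement, SimpleGraph.mem_edgeSet, potentialSign_mk]
    exact ⟨d.adj, fun hs => hd₂ (hd₁.trans (hadj d.adj hs).reachable)⟩
  · have hne : σ s(d.fst, d.snd) ≠ potentialSign θ s(d.fst, d.snd) := fun hs =>
      hd₂ (hd₁.trans (hadj d.adj (by simpa using hs)).reachable)
    have h₁ := hσ _ (G.mem_edgeSet.mpr d.adj)
    have h₂ := potentialSign_eq_or (θ := θ) s(d.fst, d.snd)
    have h₃ : potentialSign θ' s(d.fst, d.snd) = -potentialSign θ s(d.fst, d.snd) := by
      simp [θ', hd₁, hd₂]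
    simp only [mem_disagreement, h₃]
    omega

/-- A balanced signing of a connected graph is induced by a potential. -/
lemma IsBalanced.exists_potential (hG : G.Connected)
    (hσ : ∀ e ∈ G.edgeSet, σ e = 1 ∨ σ e = -1) (hb : IsBalanced G σ) :
    ∃ θ : V → ℤˣ, ∀ e ∈ G.edgeSet, σ e = potentialSign θ e := by
  classical
  obtain ⟨θ, hmin⟩ := Finite.exists_min fun θ : V → ℤˣ => (disagreement G σ θ).card
  refine ⟨θ, fun e => ?_⟩
  induction e with | _ x y
  intro he
  by_contra hne
  obtain ⟨p, hp⟩ :=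
    (connected_deleteEdges_disagreement hG hσ hmin).exists_isPath y x
  have hle := G.deleteEdges_le (disagreement G σ θ : Set (Sym2 V))
  have hgood : ∀ e ∈ (G.deleteEdges (disagreement G σ θ : Set (Sym2 V))).edgeSet,
      σ e = potentialSign θ e := by
    intro e he
    rw [SimpleGraph.edgeSet_deleteEdges] at he
    by_contra h
    exact he.2 (Finset.mem_coe.mpr (mem_disagreement.mpr ⟨he.1, h⟩))
  have hnot : s(x, y) ∉ (p.mapLe hle).edges := by
    rw [SimpleGraph.Walk.edges_mapLe_eq_edges]
    exact fun h => hne (hgood _ (p.edges_subset_edgeSet h))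
  have hcyc := hb x (.cons (G.mem_edgeSet.mp he) (p.mapLe hle))
    ((SimpleGraph.Walk.cons_isCycle_iff _ _).mpr ⟨hp.mapLe hle, hnot⟩)
  rw [SimpleGraph.Walk.edges_cons, SimpleGraph.Walk.edges_mapLe_eq_edges, List.map_cons,
    List.prod_cons, prod_edges_eq_of_potential hgood, Sym2.eq_swap (a := y)] at hcyc
  have h₁ := hσ _ he
  have h₂ := potentialSign_eq_or (θ := θ) s(x, y)
  rcases h₁ with h₁ | h₁ <;> rcases h₂ with h₂ | h₂ <;> simp_all

/-- If `θ` induces `σ` on the spanning tree `T`, then the edges with negative fundamental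
cycle are exactly the edges where `σ` disagrees with `θ`. -/
lemma negFundCount_eq_card_disagreement {T : SimpleGraph V} (hT : T.IsTree)
    (hσ : ∀ e ∈ G.edgeSet, σ e = 1 ∨ σ e = -1)
    (hθ : ∀ e ∈ T.edgeSet, σ e = potentialSign θ e) :
    negFundCount G T σ = (disagreement G σ θ).card := by
  rw [negFundCount, ← Set.ncard_coe_finset]
  congr 1
  ext e
  simp only [Set.mem_ofPred_eq, Finset.mem_coe, mem_disagreement]
  constructor
  · rintro ⟨he, -, x, y, p, -, rfl, h⟩
    rw [prod_edges_eq_of_potential hθ] at h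
    refine ⟨he, fun hs => ?_⟩
    rw [hs] at h
    rcases potentialSign_eq_or (θ := θ) s(x, y) with h' | h' <;> simp [h'] at h
  · induction e with | _ x y
    rintro ⟨he, hs⟩
    obtain ⟨p, hp⟩ := hT.connected.exists_isPath x y
    refine ⟨he, fun h => hs (hθ _ h), x, y, p, hp, rfl, ?_⟩
    rw [prod_edges_eq_of_potential hθ]
    have h₁ := hσ _ he
    have h₂ := potentialSign_eq_or (θ := θ) s(x, y)
    rcases h₁ with h₁ | h₁ <;> rcases h₂ with h₂ | h₂ <;> simp_all

variable [DecidableEq V]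

lemma frustration_le_card_disagreement (hσ : ∀ e ∈ G.edgeSet, σ e = 1 ∨ σ e = -1)
    (θ : V → ℤˣ) : frustration G σ ≤ (disagreement G σ θ).card := by
  refine Nat.sInf_le ⟨_, fun e he => (mem_disagreement.mp he).1, rfl,
    isBalanced_of_potential (θ := θ) fun e he => ?_⟩
  have h₁ := hσ _ he
  have h₂ := potentialSign_eq_or (θ := θ) e
  simp only [mem_disagreement, he, true_and]
  split_ifs <;> omega

lemma exists_card_disagreement_eq_frustration (hG : G.Connected)
    (hσ : ∀ e ∈ G.edgeSet, σ e = 1 ∨ σ e = -1) :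
    ∃ θ : V → ℤˣ, (disagreement G σ θ).card = frustration G σ := by
  obtain ⟨S, hS, hcard, hb⟩ : frustration G σ ∈ {n : ℕ | ∃ S : Finset (Sym2 V),
      ↑S ⊆ G.edgeSet ∧ S.card = n ∧ IsBalanced G (fun e => if e ∈ S then -σ e else σ e)} := by
    refine Nat.sInf_mem ⟨_, disagreement G σ 1, fun e he => (mem_disagreement.mp he).1, rfl,
      isBalanced_of_potential (θ := 1) fun e he => ?_⟩
    have h₁ := hσ _ he
    have h₂ := potentialSign_eq_or (θ := (1 : V → ℤˣ)) e
    simp only [mem_disagreement, he, true_and]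
    split_ifs <;> omega
  obtain ⟨θ, hθ⟩ := hb.exists_potential hG fun e he => by
    have := hσ e he
    split_ifs <;> omega
  refine ⟨θ, ?_⟩
  rw [← hcard]
  congr 1
  ext e
  rw [mem_disagreement]
  constructor
  · rintro ⟨he, hne⟩
    by_contra h
    exact hne (by simpa [h] using hθ e he)
  · intro h
    have he := hS h
    have h₁ := hσ e he
    have h₂ := hθ e he
    rw [if_pos h] at h₂
    exact ⟨he, by omega⟩

end

/-- Let `(G, σ)` be a signed graph with `G` connected.  The frustration
index equals the minimum over all spanning trees `T` of `G` of the number `s(T)` of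
non-tree edges whose fundamental cycle with respect to `T` is negative: `Fr(Σ) ≤ s(T)`
for every spanning tree `T`, and there is a spanning tree for which the tree-based
balancing procedure switches exactly `Fr(Σ)` edge signs. -/
theorem stmt_12 {V : Type*} [Fintype V] [DecidableEq V]
    (G : SimpleGraph V) (hG : G.Connected)
    (σ : Sym2 V → ℤ) (hσ : ∀ e ∈ G.edgeSet, σ e = 1 ∨ σ e = -1) :
    (∀ T : SimpleGraph V, T ≤ G → T.IsTree →
      frustration G σ ≤ negFundCount G T σ) ∧
    (∃ T : SimpleGraph V, T ≤ G ∧ T.IsTree ∧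
      negFundCount G T σ = frustration G σ) := by
  constructor
  · intro T hTG hT
    have hσT : ∀ e ∈ T.edgeSet, σ e = 1 ∨ σ e = -1 := fun e he =>
      hσ e (SimpleGraph.edgeSet_mono hTG he)
    obtain ⟨θ, hθ⟩ := IsBalanced.exists_potential hT.connected hσT
      fun v c hc => absurd hc (hT.isAcyclic c)
    rw [negFundCount_eq_card_disagreement hT hσ hθ]
    exact frustration_le_card_disagreement hσ θ
  · obtain ⟨θ, hθ⟩ := exists_card_disagreement_eq_frustration hG hσ
    obtain ⟨T, hTH, hT⟩ := (connected_deleteEdges_disagreement hG hσ (θ := θ) fun θ' =>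
      hθ.trans_le (frustration_le_card_disagreement hσ θ')).exists_isTree_le
    refine ⟨T, hTH.trans (G.deleteEdges_le _), hT, ?_⟩
    rw [negFundCount_eq_card_disagreement hT hσ fun e he => ?_, hθ]
    have he' := SimpleGraph.edgeSet_mono hTH he
    rw [SimpleGraph.edgeSet_deleteEdges] at he'
    by_contra h
    exact he'.2 (Finset.mem_coe.mpr (mem_disagreement.mpr ⟨he'.1, h⟩))
end
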